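/- Under the hypotheses of the main spectral lemma (A, B positive semidefinite, ‖A+B‖ ≤ 1+ε₁, ‖B‖ ≥ 1, tr Π^{A+B}A ≥ ε tr Π^{A+B}(A+B), tr Π^B B ≥ (1-ε₁⁹) tr Π^{A+B}(A+B)), decompose the space using the Jordan decomposition of Π^B and Π^{A+B} into invariant subspaces V₁,...,V_k (and W where both vanish). Define I = {i : tr Π^{Aᵢ+Bᵢ}Bᵢ ≤ (1-ε²) tr Π^{Aᵢ+Bᵢ}(Aᵢ+Bᵢ)} and J = {i : tr Π^{Bᵢ}Bᵢ ≥ (1-ε₁⁸) tr Π^{Aᵢ+Bᵢ}(Aᵢ+Bᵢ)}. Then |I ∩ J| > (99/100)εk. -/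

import Mathlib

open scoped ComplexOrder

/-- The `ℓ²`-operator norm of a complex square matrix. -/
noncomputable def opNorm {n : ℕ} (M : Matrix (Fin n) (Fin n) ℂ) : ℝ :=
  ‖Matrix.toEuclideanCLM (𝕜 := ℂ) M‖

/-- The spectral projection of a Hermitian matrix onto the span of its
eigenvectors with eigenvalue at least `1`. -/
noncomputable def specProj {n : ℕ} {M : Matrix (Fin n) (Fin n) ℂ}
    (hM : M.IsHermitian) : Matrix (Fin n) (Fin n) ℂ :=
  ∑ i ∈ Finset.univ.filter (fun i => 1 ≤ hM.eigenvalues i),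
    Matrix.vecMulVec (hM.eigenvectorBasis i) (star (hM.eigenvectorBasis i))

/-- `N_l(M)`: the sum of the eigenvalues of a Hermitian matrix `M` that are at
least `l`. -/
noncomputable def sumEigAbove {n : ℕ} {M : Matrix (Fin n) (Fin n) ℂ}
    (hM : M.IsHermitian) (l : ℝ) : ℝ :=
  ∑ i ∈ Finset.univ.filter (fun i => l ≤ hM.eigenvalues i), hM.eigenvalues i

section aux
variable {n : ℕ}

/-- The operator of a matrix. -/
noncomputable abbrev TT (X : Matrix (Fin n) (Fin n) ℂ) :
    EuclideanSpace ℂ (Fin n) →L[ℂ] EuclideanSpace ℂ (Fin n) :=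
  Matrix.toEuclideanCLM (𝕜 := ℂ) X

/-- quadratic form -/
noncomputable def qf (X : Matrix (Fin n) (Fin n) ℂ) (v : EuclideanSpace ℂ (Fin n)) : ℝ :=
  (inner ℂ v (TT X v)).re

lemma TT_mul (X Y : Matrix (Fin n) (Fin n) ℂ) (v) : TT (X * Y) v = TT X (TT Y v) := by
  simp [TT]

lemma TT_symm {X : Matrix (Fin n) (Fin n) ℂ} (hX : X.IsHermitian) (v w) :
    inner ℂ (TT X v) w = inner ℂ v (TT X w) :=
  (Matrix.isSymmetric_toEuclideanLin_iff.mpr hX) v w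

lemma TT_eig {M : Matrix (Fin n) (Fin n) ℂ} (hM : M.IsHermitian) (j) :
    TT M (hM.eigenvectorBasis j) = (hM.eigenvalues j : ℂ) • hM.eigenvectorBasis j := by
  apply (WithLp.ofLp_injective 2)
  have := hM.mulVec_eigenvectorBasis j
  simpa [TT] using this

lemma inner_TT {M : Matrix (Fin n) (Fin n) ℂ} (hM : M.IsHermitian) (j) (v) :
    inner ℂ (hM.eigenvectorBasis j) (TT M v)
      = (hM.eigenvalues j : ℂ) * inner ℂ (hM.eigenvectorBasis j) v := by
  rw [← TT_symm hM, TT_eig, inner_smul_left]; simp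

lemma qf_eq {M : Matrix (Fin n) (Fin n) ℂ} (hM : M.IsHermitian) (v) :
    qf M v = ∑ j, hM.eigenvalues j * ‖inner ℂ (hM.eigenvectorBasis j) v‖ ^ 2 := by
  unfold qf
  rw [← hM.eigenvectorBasis.sum_inner_mul_inner, Complex.re_sum]
  refine Finset.sum_congr rfl fun j _ => ?_
  rw [inner_TT, ← inner_conj_symm v, mul_left_comm, mul_comm (starRingEnd ℂ _), Complex.mul_conj,
    ← Complex.ofReal_mul, Complex.ofReal_re, Complex.normSq_eq_norm_sq]

lemma TT_vec (u v : EuclideanSpace ℂ (Fin n)) :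
    TT (Matrix.vecMulVec u (star u)) v = (inner ℂ u v : ℂ) • u := by
  apply (WithLp.ofLp_injective 2)
  ext k
  simp [TT, Matrix.vecMulVec_mulVec, EuclideanSpace.inner_eq_star_dotProduct, dotProduct_comm,
    mul_comm]

lemma TT_specProj {M : Matrix (Fin n) (Fin n) ℂ} (hM : M.IsHermitian) (v) :
    TT (specProj hM) v = ∑ j ∈ Finset.univ.filter (fun i => 1 ≤ hM.eigenvalues i),
      (inner ℂ (hM.eigenvectorBasis j) v : ℂ) • hM.eigenvectorBasis j := by
  unfold specProj
  simp only [TT, map_sum, _root_.sum_apply]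
  exact Finset.sum_congr rfl fun j _ => TT_vec _ _

lemma TT_specProj_eig {M : Matrix (Fin n) (Fin n) ℂ} (hM : M.IsHermitian) (j) :
    TT (specProj hM) (hM.eigenvectorBasis j) =
      if 1 ≤ hM.eigenvalues j then hM.eigenvectorBasis j else 0 := by
  rw [TT_specProj]
  simp [orthonormal_iff_ite.mp hM.eigenvectorBasis.orthonormal, ite_smul]

lemma TT_ext {M : Matrix (Fin n) (Fin n) ℂ} (hM : M.IsHermitian) {X Y : Matrix (Fin n) (Fin n) ℂ}
    (h : ∀ j, TT X (hM.eigenvectorBasis j) = TT Y (hM.eigenvectorBasis j)) : X = Y := by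
  apply (Matrix.toEuclideanCLM (𝕜 := ℂ)).injective
  have : (TT X).toLinearMap = (TT Y).toLinearMap := by
    refine hM.eigenvectorBasis.toBasis.ext (fun j => ?_)
    rw [OrthonormalBasis.coe_toBasis]
    exact h j
  exact ContinuousLinearMap.coe_injective this

lemma specProj_comm {M : Matrix (Fin n) (Fin n) ℂ} (hM : M.IsHermitian) :
    specProj hM * M = M * specProj hM := by
  apply TT_ext hM
  intro j
  rw [TT_mul, TT_mul, TT_eig, map_smul, TT_specProj_eig]
  split_ifs
  · rw [TT_eig]
  · simp

lemma inner_specProj {M : Matrix (Fin n) (Fin n) ℂ} (hM : M.IsHermitian) (j) (v) :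
    inner ℂ (hM.eigenvectorBasis j) (TT (specProj hM) v) =
      if 1 ≤ hM.eigenvalues j then inner ℂ (hM.eigenvectorBasis j) v else 0 := by
  rw [TT_specProj, inner_sum]
  simp [inner_smul_right, orthonormal_iff_ite.mp hM.eigenvectorBasis.orthonormal]

lemma qf_ge {M : Matrix (Fin n) (Fin n) ℂ} (hM : M.IsHermitian) (v)
    (hv : TT (specProj hM) v = v) : ‖v‖ ^ 2 ≤ qf M v := by
  rw [qf_eq hM, ← hM.eigenvectorBasis.sum_sq_norm_inner_right]
  refine Finset.sum_le_sum fun j _ => ?_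
  have := inner_specProj hM j v
  rw [hv] at this
  split_ifs at this with h
  · nlinarith [sq_nonneg ‖inner ℂ (hM.eigenvectorBasis j) v‖]
  · simp [this]

lemma qf_lt' {M : Matrix (Fin n) (Fin n) ℂ} (hM : M.IsHermitian) (v) (h0 : v ≠ 0)
    (hv : ∀ j, 1 ≤ hM.eigenvalues j → inner ℂ (hM.eigenvectorBasis j) v = 0) :
    qf M v < ‖v‖ ^ 2 := by
  rw [qf_eq hM, ← hM.eigenvectorBasis.sum_sq_norm_inner_right]
  have key : ∀ j, hM.eigenvalues j * ‖inner ℂ (hM.eigenvectorBasis j) v‖ ^ 2 ≤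
      ‖inner ℂ (hM.eigenvectorBasis j) v‖ ^ 2 := by
    intro j
    by_cases h : 1 ≤ hM.eigenvalues j
    · simp [hv j h]
    · nlinarith [sq_nonneg ‖inner ℂ (hM.eigenvectorBasis j) v‖]
  refine Finset.sum_lt_sum (fun j _ => key j) ?_
  by_contra! hc
  apply h0
  rw [← hM.eigenvectorBasis.sum_repr' v]
  refine Finset.sum_eq_zero fun j _ => ?_
  by_cases h : 1 ≤ hM.eigenvalues j
  · simp [hv j h]
  · have h1 := hc j (Finset.mem_univ j)
    have h2 : ‖inner ℂ (hM.eigenvectorBasis j) v‖ ^ 2 = 0 := by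
      nlinarith [sq_nonneg ‖inner ℂ (hM.eigenvectorBasis j) v‖]
    have h3 : inner ℂ (hM.eigenvectorBasis j) v = 0 := by simpa using h2
    simp [h3]

lemma qf_lt {M : Matrix (Fin n) (Fin n) ℂ} (hM : M.IsHermitian) (v) (h0 : v ≠ 0)
    (hv : TT (specProj hM) v = 0) : qf M v < ‖v‖ ^ 2 := by
  apply qf_lt' hM v h0
  intro j hj
  have := inner_specProj hM j v
  rw [hv, if_pos hj] at this
  simpa using this.symm

lemma specProj_unique {X : Matrix (Fin n) (Fin n) ℂ} (hX : X.IsHermitian)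
    (R : Matrix (Fin n) (Fin n) ℂ) (hR : R * R = R) (hc : R * X = X * R)
    (h1 : ∀ v, TT R v = v → ‖v‖ ^ 2 ≤ qf X v)
    (h2 : ∀ v, v ≠ 0 → TT R v = 0 → qf X v < ‖v‖ ^ 2) : specProj hX = R := by
  apply TT_ext hX
  intro j
  rw [TT_specProj_eig]
  set u := hX.eigenvectorBasis j with hu
  have hRu : TT X (TT R u) = (hX.eigenvalues j : ℂ) • TT R u := by
    rw [← TT_mul, ← hc, TT_mul, TT_eig, map_smul]
  have hq : ∀ w, TT X w = (hX.eigenvalues j : ℂ) • w → qf X w = hX.eigenvalues j * ‖w‖ ^ 2 := by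
    intro w hw
    unfold qf
    rw [hw, inner_smul_right, inner_self_eq_norm_sq_to_K]
    norm_cast
    exact Complex.re_ofReal_mul _ _
  split_ifs with h
  · by_contra hne
    have hw0 : u - TT R u ≠ 0 := fun hh => hne (sub_eq_zero.mp hh)
    have := h2 _ hw0 (by rw [map_sub, ← TT_mul, hR, sub_self])
    rw [hq _ (by rw [map_sub, hRu, TT_eig, smul_sub])] at this
    nlinarith [sq_nonneg ‖u - TT R u‖]
  · by_contra hne
    have := h1 (TT R u) (by rw [← TT_mul, hR])
    rw [hq _ hRu] at this
    have : 0 < ‖TT R u‖ := norm_pos_iff.mpr (Ne.symm hne)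
    nlinarith [pow_pos this 2]

lemma specProj_idem {M : Matrix (Fin n) (Fin n) ℂ} (hM : M.IsHermitian) :
    specProj hM * specProj hM = specProj hM := by
  apply TT_ext hM
  intro j
  rw [TT_mul, TT_specProj_eig]
  split_ifs with h
  · rw [TT_specProj_eig, if_pos h]
  · simp

lemma qf_conj {V M : Matrix (Fin n) (Fin n) ℂ} (hV : V.IsHermitian) (v) :
    qf (V * M * V) v = qf M (TT V v) := by
  unfold qf
  rw [TT_mul, TT_mul, ← TT_symm hV]

lemma norm_proj_le {V : Matrix (Fin n) (Fin n) ℂ} (hV : V.IsHermitian) (hV2 : V * V = V) (v) :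
    ‖TT V v‖ ≤ ‖v‖ := by
  have h1 : ‖TT V v‖ ^ 2 ≤ ‖v‖ * ‖TT V v‖ := by
    have : (inner ℂ v (TT V v)) = ((‖TT V v‖ ^ 2 : ℝ) : ℂ) := by
      have h := TT_symm hV v (TT V v)
      rw [← TT_mul, hV2, inner_self_eq_norm_sq_to_K] at h
      rw [← h]; norm_cast
    have h := norm_inner_le_norm (𝕜 := ℂ) v (TT V v)
    rw [this] at h
    simpa using h
  by_contra! hc
  nlinarith [norm_nonneg v]

lemma specProj_compress {M V : Matrix (Fin n) (Fin n) ℂ} (hM : M.IsHermitian)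
    (hV : V.IsHermitian) (hV2 : V * V = V) (hc : specProj hM * V = V * specProj hM)
    (hX : (V * M * V).IsHermitian) : specProj hX = specProj hM * V := by
  set P := specProj hM with hP
  have hPP : P * P = P := specProj_idem hM
  have hPM : P * M = M * P := specProj_comm hM
  apply specProj_unique
  · calc P * V * (P * V) = P * (V * P) * V := by noncomm_ring
      _ = (P * P) * (V * V) := by rw [← hc]; noncomm_ring
      _ = P * V := by rw [hPP, hV2]
  · calc P * V * (V * M * V) = P * (V * V) * M * V := by noncomm_ring
      _ = (P * V) * M * V := by rw [hV2]
      _ = V * (P * M) * V := by rw [hc]; noncomm_ring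
      _ = V * M * (P * V) := by rw [hPM]; noncomm_ring
      _ = V * M * (P * (V * V)) := by rw [hV2]
      _ = V * M * ((P * V) * V) := by noncomm_ring
      _ = V * M * V * (P * V) := by rw [hc]; nth_rw 1 [← hV2]; simp only [mul_assoc, hc]; simp only [← mul_assoc, hV2]
  · intro v hv
    have h1 : TT V v = v := by
      conv_lhs => rw [← hv, ← TT_mul, hc, ← mul_assoc, hV2, ← hc, hv]
    have h2 : TT P v = v := by
      rw [TT_mul, h1] at hv; exact hv
    rw [qf_conj hV, h1]
    exact qf_ge hM v h2
  · intro v h0 hv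
    rw [qf_conj hV]
    by_cases h : TT V v = 0
    · rw [h]; simp only [qf, map_zero, inner_zero_right, Complex.zero_re]; have := norm_pos_iff.mpr h0; positivity
    · have := qf_lt hM (TT V v) h (by rw [← TT_mul]; exact hv)
      have h3 := norm_proj_le hV hV2 v
      nlinarith [norm_nonneg (TT V v)]

lemma trace_vec (u : EuclideanSpace ℂ (Fin n)) (X : Matrix (Fin n) (Fin n) ℂ) :
    (Matrix.vecMulVec u (star u) * X).trace = inner ℂ u (TT X u) := by
  rw [Matrix.trace_mul_comm, Matrix.mul_vecMulVec, Matrix.trace_vecMulVec,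
    EuclideanSpace.inner_eq_star_dotProduct]
  rfl

lemma trace_specProj {M : Matrix (Fin n) (Fin n) ℂ} (hM : M.IsHermitian)
    (X : Matrix (Fin n) (Fin n) ℂ) : ((specProj hM * X).trace).re =
      ∑ j ∈ Finset.univ.filter (fun i => 1 ≤ hM.eigenvalues i), qf X (hM.eigenvectorBasis j) := by
  unfold specProj
  rw [Finset.sum_mul, Matrix.trace_sum, Complex.re_sum]
  exact Finset.sum_congr rfl fun j _ => by rw [trace_vec]; rfl

lemma qf_nonneg {X : Matrix (Fin n) (Fin n) ℂ} (hX : X.PosSemidef) (v) : 0 ≤ qf X v := by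
  have := hX.dotProduct_mulVec_nonneg v.ofLp
  unfold qf
  rw [EuclideanSpace.inner_eq_star_dotProduct, dotProduct_comm]
  exact (Complex.le_def.mp this).1

lemma qf_add (X Y : Matrix (Fin n) (Fin n) ℂ) (v) : qf (X + Y) v = qf X v + qf Y v := by
  simp [qf, TT]

lemma qf_eig {M : Matrix (Fin n) (Fin n) ℂ} (hM : M.IsHermitian) (j) :
    qf M (hM.eigenvectorBasis j) = hM.eigenvalues j := by
  unfold qf
  rw [TT_eig, inner_smul_right, inner_self_eq_norm_sq_to_K]
  simp

lemma card_le {M B : Matrix (Fin n) (Fin n) ℂ} (hM : M.IsHermitian) (hB : B.IsHermitian)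
    (h : ∀ v, qf B v ≤ qf M v) :
    (Finset.univ.filter (fun i => 1 ≤ hB.eigenvalues i)).card ≤
      (Finset.univ.filter (fun i => 1 ≤ hM.eigenvalues i)).card := by
  classical
  by_contra! hlt
  set T := Finset.univ.filter (fun i => 1 ≤ hB.eigenvalues i) with hT
  set S := Finset.univ.filter (fun i => 1 ≤ hM.eigenvalues i) with hS
  let g : (T → ℂ) →ₗ[ℂ] EuclideanSpace ℂ (Fin n) :=
    Fintype.linearCombination ℂ (fun t : T => hB.eigenvectorBasis t)
  let f : (T → ℂ) →ₗ[ℂ] (S → ℂ) :=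
    LinearMap.pi (fun s : S => (innerSL ℂ (hM.eigenvectorBasis s) : _ →ₗ[ℂ] ℂ) ∘ₗ g)
  have hk : f.ker ≠ ⊥ := LinearMap.ker_ne_bot_of_finrank_lt (by simpa using hlt)
  obtain ⟨c, hc, hc0⟩ := (Submodule.ne_bot_iff _).mp hk
  have hli : LinearIndependent ℂ (fun t : T => hB.eigenvectorBasis t) :=
    hB.eigenvectorBasis.orthonormal.linearIndependent.comp _ Subtype.val_injective
  have hg0 : g c ≠ 0 := by
    intro h0
    apply hc0
    have := (Fintype.linearIndependent_iff.mp hli) c (by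
      simpa [g, Fintype.linearCombination_apply] using h0)
    ext t; exact this t
  have h1 : qf M (g c) < ‖g c‖ ^ 2 := by
    apply qf_lt' hM _ hg0
    intro j hj
    have := congrFun (LinearMap.mem_ker.mp hc) ⟨j, by simp [hS, hj]⟩
    simpa [f] using this
  have h2 : ‖g c‖ ^ 2 ≤ qf B (g c) := by
    apply qf_ge hB
    simp only [g, Fintype.linearCombination_apply, map_sum, map_smul]
    refine Finset.sum_congr rfl fun t _ => ?_
    rw [TT_specProj_eig, if_pos (Finset.mem_filter.mp t.2).2]
  linarith [h (g c)]

lemma trace_mono {M B : Matrix (Fin n) (Fin n) ℂ} (hM : M.IsHermitian) (hB : B.IsHermitian)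
    (h : ∀ v, qf B v ≤ qf M v) :
    ((specProj hB * B).trace).re ≤ ((specProj hM * M).trace).re := by
  have hcard := card_le hM hB h
  rw [trace_specProj, trace_specProj]
  set T := Finset.univ.filter (fun i => 1 ≤ hB.eigenvalues i) with hT
  set S := Finset.univ.filter (fun i => 1 ≤ hM.eigenvalues i) with hS
  have e1 : ∑ t ∈ T, (qf M (hB.eigenvectorBasis t) - 1) ≤ ∑ s ∈ S, (hM.eigenvalues s - 1) := by
    calc ∑ t ∈ T, (qf M (hB.eigenvectorBasis t) - 1)
        = ∑ t ∈ T, ∑ l, (hM.eigenvalues l - 1) *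
            ‖inner ℂ (hM.eigenvectorBasis l) (hB.eigenvectorBasis t)‖ ^ 2 := by
          refine Finset.sum_congr rfl fun t _ => ?_
          simp only [sub_mul, one_mul, Finset.sum_sub_distrib]
          rw [← qf_eq hM, hM.eigenvectorBasis.sum_sq_norm_inner_right]
          simp
      _ = ∑ l, (hM.eigenvalues l - 1) * ∑ t ∈ T,
            ‖inner ℂ (hM.eigenvectorBasis l) (hB.eigenvectorBasis t)‖ ^ 2 := by
          rw [Finset.sum_comm]
          simp only [Finset.mul_sum]
      _ ≤ ∑ l, (if 1 ≤ hM.eigenvalues l then hM.eigenvalues l - 1 else 0) := by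
          refine Finset.sum_le_sum fun l _ => ?_
          have a0 : 0 ≤ ∑ t ∈ T,
            ‖inner ℂ (hM.eigenvectorBasis l) (hB.eigenvectorBasis t)‖ ^ 2 := by positivity
          have a1 : ∑ t ∈ T,
            ‖inner ℂ (hM.eigenvectorBasis l) (hB.eigenvectorBasis t)‖ ^ 2 ≤ 1 := by
            have := hB.eigenvectorBasis.orthonormal.sum_inner_products_le
              (hM.eigenvectorBasis l) (s := T)
            simpa [norm_inner_symm] using this
          split_ifs with hl
          · nlinarith
          · nlinarith
      _ = _ := by rw [hS, Finset.sum_filter]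
  have e2 : ∑ t ∈ T, qf B (hB.eigenvectorBasis t) ≤ ∑ t ∈ T, qf M (hB.eigenvectorBasis t) :=
    Finset.sum_le_sum fun t _ => h _
  have e3 : ∑ s ∈ S, qf M (hM.eigenvectorBasis s) = ∑ s ∈ S, hM.eigenvalues s :=
    Finset.sum_congr rfl fun s _ => qf_eig hM s
  rw [Finset.sum_sub_distrib, Finset.sum_sub_distrib] at e1
  simp only [Finset.sum_const, nsmul_eq_mul, mul_one] at e1
  have : (T.card : ℝ) ≤ S.card := by exact_mod_cast hcard
  linarith

lemma exists_eig {B : Matrix (Fin n) (Fin n) ℂ} (hB : B.PosSemidef) (h : 1 ≤ opNorm B) :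
    specProj hB.1 ≠ 0 := by
  intro h0
  have hlt : ∀ j, hB.1.eigenvalues j < 1 := by
    intro j
    by_contra! hj
    have := TT_specProj_eig hB.1 j
    rw [h0, if_pos hj] at this
    have h2 := hB.1.eigenvectorBasis.orthonormal.1 j
    rw [← this] at h2
    simp [TT] at h2
  obtain ⟨m, hm0, hm1, hm⟩ : ∃ m : ℝ, 0 ≤ m ∧ m < 1 ∧ ∀ j, hB.1.eigenvalues j ≤ m := by
    rcases isEmpty_or_nonempty (Fin n) with he | he
    · exact ⟨0, le_rfl, one_pos, fun j => isEmptyElim j⟩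
    · obtain ⟨j, hj⟩ := Finite.exists_max hB.1.eigenvalues
      exact ⟨_, hB.eigenvalues_nonneg j, hlt j, hj⟩
  have : opNorm B ≤ m := by
    unfold opNorm
    refine ContinuousLinearMap.opNorm_le_bound _ hm0 fun v => ?_
    refine le_of_sq_le_sq ?_ (by positivity)
    rw [mul_pow, ← hB.1.eigenvectorBasis.sum_sq_norm_inner_right,
      ← hB.1.eigenvectorBasis.sum_sq_norm_inner_right v, Finset.mul_sum]
    refine Finset.sum_le_sum fun j _ => ?_
    have e := inner_TT hB.1 j v
    unfold TT at e
    rw [e, norm_mul, mul_pow]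
    gcongr
    simpa [abs_of_nonneg (hB.eigenvalues_nonneg j)] using hm j
  linarith

lemma trace_compress {P V X : Matrix (Fin n) (Fin n) ℂ} (hV2 : V * V = V)
    (hc : P * V = V * P) : (P * V * (V * X * V)).trace = (P * V * X).trace := by
  have : P * V * (V * X * V) = (P * (V * V) * X) * V := by noncomm_ring
  rw [this, Matrix.trace_mul_comm, hV2]
  congr 1
  calc V * (P * V * X) = (V * P) * V * X := by noncomm_ring
    _ = P * (V * V) * X := by rw [← hc]; noncomm_ring
    _ = P * V * X := by rw [hV2]

lemma trace_sum_compress {k : ℕ} {P W : Matrix (Fin n) (Fin n) ℂ}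
    {V : Fin k → Matrix (Fin n) (Fin n) ℂ} (hV2 : ∀ i, V i * V i = V i)
    (hc : ∀ i, P * V i = V i * P) (hW : P * W = 0) (hs : ∑ i, V i + W = 1)
    (X : Matrix (Fin n) (Fin n) ℂ) :
    ∑ i, ((P * V i * (V i * X * V i)).trace).re = ((P * X).trace).re := by
  have h1 : P * X = ∑ i, P * V i * X := by
    have : P * X = P * (∑ i, V i + W) * X := by rw [hs, mul_one]
    rw [this, mul_add, hW, add_zero, Finset.mul_sum, Finset.sum_mul]
  rw [h1, Matrix.trace_sum, Complex.re_sum]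
  exact Finset.sum_congr rfl fun i _ => by rw [trace_compress (hV2 i) (hc i)]

end aux

lemma count_aux {k : ℕ} (hk : 0 < k) (ε ε₁ : ℝ) (h0 : 0 < ε) (hε : ε < 1 / 1000) (h1 : 0 < ε₁)
    (h1' : ε₁ ≤ ε / 1000) (m b q : Fin k → ℝ) (hm : ∀ i, 1 ≤ m i ∧ m i ≤ 1 + ε₁)
    (hb : ∀ i, 0 ≤ b i) (hq : ∀ i, q i ≤ m i)
    (hI : ε * ∑ i, m i ≤ ∑ i, m i - ∑ i, b i)
    (hJ : (1 - ε₁ ^ 9) * ∑ i, m i ≤ ∑ i, q i) :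
    (99 / 100 : ℝ) * ε * (k : ℝ) <
      ((Finset.univ.filter (fun i : Fin k => b i ≤ (1 - ε ^ 2) * m i)) ∩
        (Finset.univ.filter (fun i : Fin k => (1 - ε₁ ^ 8) * m i ≤ q i))).card := by
  set I := Finset.univ.filter (fun i : Fin k => b i ≤ (1 - ε ^ 2) * m i) with hId
  set J := Finset.univ.filter (fun i : Fin k => (1 - ε₁ ^ 8) * m i ≤ q i) with hJd
  set S := ∑ i, m i with hS
  have hS1 : (k : ℝ) ≤ S := by
    have : ∑ i : Fin k, (1 : ℝ) ≤ S := Finset.sum_le_sum fun i _ => (hm i).1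
    simpa using this
  have hS2 : S ≤ k * (1 + ε₁) := by
    have : S ≤ ∑ i : Fin k, (1 + ε₁) := Finset.sum_le_sum fun i _ => (hm i).2
    rw [Finset.sum_const, nsmul_eq_mul] at this
    simpa only [Finset.card_univ, Fintype.card_fin] using this
  have e1 : S - ∑ i, b i ≤ ε ^ 2 * S + (1 + ε₁) * I.card := by
    have : ∑ i, (m i - b i) ≤ ∑ i, (ε ^ 2 * m i + (if b i ≤ (1 - ε ^ 2) * m i then 1 + ε₁ else 0)) := by
      refine Finset.sum_le_sum fun i _ => ?_
      have := hm i
      have := hb i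
      split_ifs with h
      · nlinarith [sq_nonneg ε]
      · nlinarith
    rw [Finset.sum_sub_distrib, Finset.sum_add_distrib, ← Finset.mul_sum, ← Finset.sum_filter,
      Finset.sum_const, nsmul_eq_mul] at this
    linarith
  have p8 : 0 < ε₁ ^ 8 := by positivity
  have e2 : ε₁ ^ 8 * (Jᶜ).card ≤ S - ∑ i, q i := by
    have : ∑ i, (if ¬ ((1 - ε₁ ^ 8) * m i ≤ q i) then ε₁ ^ 8 else 0) ≤ ∑ i, (m i - q i) := by
      refine Finset.sum_le_sum fun i _ => ?_
      have := hm i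
      have := hq i
      split_ifs with h
      · linarith
      · push Not at h
        have : ε₁ ^ 8 * 1 ≤ ε₁ ^ 8 * m i := mul_le_mul_of_nonneg_left (hm i).1 p8.le
        linarith
    rw [Finset.sum_sub_distrib, ← Finset.sum_filter, Finset.sum_const, nsmul_eq_mul,
      ← Finset.compl_filter] at this
    linarith
  have e3 : ((Jᶜ).card : ℝ) ≤ ε₁ * S := by
    have : ε₁ ^ 8 * (Jᶜ).card ≤ ε₁ ^ 8 * (ε₁ * S) := by nlinarith
    exact le_of_mul_le_mul_left this p8
  have e4 : (I.card : ℝ) ≤ (I ∩ J).card + (Jᶜ).card := by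
    have : I ⊆ (I ∩ J) ∪ Jᶜ := by
      intro i hi
      by_cases h : i ∈ J <;> simp [hi, h]
    exact_mod_cast (Finset.card_le_card this).trans (Finset.card_union_le _ _)
  have hk' : (0 : ℝ) < k := by exact_mod_cast hk
  have f1 : (ε - ε ^ 2) * k ≤ (1 + ε₁) * I.card := by
    have : (ε - ε ^ 2) * k ≤ (ε - ε ^ 2) * S := mul_le_mul_of_nonneg_left hS1 (by nlinarith)
    linarith
  have f2 : (999 / 1000) * (ε * k) ≤ (1 + ε₁) * I.card := by nlinarith [mul_pos h0 hk']
  have f3 : (998 / 1000) * (ε * k) ≤ I.card := by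
    have : (I.card : ℝ) * (1 + ε₁) ≤ I.card * (1001 / 1000) :=
      mul_le_mul_of_nonneg_left (by linarith) (by positivity)
    nlinarith [mul_pos h0 hk']
  have f4 : ε₁ * S ≤ (2 / 1000) * (ε * k) := by
    have a : ε₁ * S ≤ (ε / 1000) * (k * 2) := by
      apply mul_le_mul h1' _ (by linarith) (by linarith)
      exact hS2.trans (mul_le_mul_of_nonneg_left (by linarith) hk'.le)
    linarith
  nlinarith [mul_pos h0 hk']

/-- Under the hypotheses of the main spectral lemma, with the
Jordan decomposition of `Π^B` and `Π^{A+B}` into invariant subspaces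
`V₁, …, V_k` (and `W` where both vanish), and with the standard remarks
(`1 ≤ tr Π^{Aᵢ+Bᵢ}(Aᵢ+Bᵢ) ≤ 1+ε₁` for all `i`, and
`k ≤ N(A+B) ≤ k(1+ε₁)`) in place, the sets
`I = {i : tr Π^{Aᵢ+Bᵢ}Bᵢ ≤ (1-ε²) tr Π^{Aᵢ+Bᵢ}(Aᵢ+Bᵢ)}` and
`J = {i : tr Π^{Bᵢ}Bᵢ ≥ (1-ε₁⁸) tr Π^{Aᵢ+Bᵢ}(Aᵢ+Bᵢ)}` satisfy
`|I ∩ J| > (99/100) ε k`. -/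
theorem setIJ_lemma :
    ∃ c : ℝ, 0 < c ∧ ∃ N₀ : ℕ, ∀ n : ℕ, N₀ ≤ n →
      ∀ ε : ℝ, 0 < ε → ε < c →
      ∀ ε₁ : ℝ, ε₁ = 3 * ε / Real.log n →
      ∀ (A B : Matrix (Fin n) (Fin n) ℂ)
        (hA : A.PosSemidef) (hB : B.PosSemidef) (hAB : (A + B).IsHermitian),
        opNorm (A + B) ≤ 1 + ε₁ →
        1 ≤ opNorm B →
        ε * ((specProj hAB * (A + B)).trace).re ≤ ((specProj hAB * A).trace).re →
        (1 - ε₁ ^ 9) * ((specProj hAB * (A + B)).trace).re ≤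
          ((specProj hB.1 * B).trace).re →
      ∀ (k : ℕ) (V : Fin k → Matrix (Fin n) (Fin n) ℂ)
        (W : Matrix (Fin n) (Fin n) ℂ),
        (∀ i, (V i).IsHermitian ∧ V i * V i = V i) →
        (W.IsHermitian ∧ W * W = W) →
        (∀ i j, i ≠ j → V i * V j = 0) →
        (∀ i, V i * W = 0) →
        (∑ i, V i + W = 1) →
        (∀ i, specProj hB.1 * V i = V i * specProj hB.1) →
        (∀ i, specProj hAB * V i = V i * specProj hAB) →
        specProj hB.1 * W = 0 →
        specProj hAB * W = 0 →
      ∀ (hABi : ∀ i, (V i * (A + B) * V i).IsHermitian)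
        (hBi : ∀ i, (V i * B * V i).IsHermitian),
        (∀ i, 1 ≤ ((specProj (hABi i) * (V i * (A + B) * V i)).trace).re ∧
          ((specProj (hABi i) * (V i * (A + B) * V i)).trace).re ≤ 1 + ε₁) →
        ((k : ℝ) ≤ sumEigAbove hAB 1 ∧ sumEigAbove hAB 1 ≤ (k : ℝ) * (1 + ε₁)) →
        (99 / 100 : ℝ) * ε * (k : ℝ) <
          ((Finset.univ.filter (fun i : Fin k =>
              ((specProj (hABi i) * (V i * B * V i)).trace).re ≤
                (1 - ε ^ 2) *
                  ((specProj (hABi i) * (V i * (A + B) * V i)).trace).re)) ∩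
            (Finset.univ.filter (fun i : Fin k =>
              (1 - ε₁ ^ 8) *
                  ((specProj (hABi i) * (V i * (A + B) * V i)).trace).re ≤
                ((specProj (hBi i) * (V i * B * V i)).trace).re))).card := by
  refine ⟨1 / 1000, by norm_num, ⌈Real.exp 3000⌉₊, ?_⟩
  intro n hn ε h0 hε ε₁ hε₁ A B hA hB hAB _ hBn hI hJ k V W hV hW hVV hVW hs hcB hcAB hWB hWAB
    hABi hBi hm _
  have hlog : 3000 ≤ Real.log n := by
    have : Real.exp 3000 ≤ n := (Nat.le_ceil _).trans (by exact_mod_cast hn)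
    exact (Real.le_log_iff_exp_le (lt_of_lt_of_le (Real.exp_pos _) this)).mpr this
  have h1 : 0 < ε₁ := by
    rw [hε₁]; exact div_pos (by linarith) (by linarith)
  have h1' : ε₁ ≤ ε / 1000 := by
    rw [hε₁, div_le_div_iff₀ (by linarith) (by norm_num)]
    nlinarith
  have hk : 0 < k := by
    rcases Nat.eq_zero_or_pos k with rfl | h
    · exfalso
      have hW1 : W = 1 := by simpa using hs
      rw [hW1, mul_one] at hWB
      exact exists_eig hB hBn hWB
    · exact h
  have hP : ∀ i, specProj (hABi i) = specProj hAB * V i := fun i =>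
    specProj_compress hAB (hV i).1 (hV i).2 (hcAB i) (hABi i)
  have hQ : ∀ i, specProj (hBi i) = specProj hB.1 * V i := fun i =>
    specProj_compress hB.1 (hV i).1 (hV i).2 (hcB i) (hBi i)
  have s1 : ∑ i, ((specProj (hABi i) * (V i * (A + B) * V i)).trace).re =
      ((specProj hAB * (A + B)).trace).re := by
    simp only [hP]
    exact trace_sum_compress (fun i => (hV i).2) hcAB hWAB hs _
  have s2 : ∑ i, ((specProj (hABi i) * (V i * B * V i)).trace).re =
      ((specProj hAB * B).trace).re := by
    simp only [hP]
    exact trace_sum_compress (fun i => (hV i).2) hcAB hWAB hs _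
  have s3 : ∑ i, ((specProj (hBi i) * (V i * B * V i)).trace).re =
      ((specProj hB.1 * B).trace).re := by
    simp only [hQ]
    exact trace_sum_compress (fun i => (hV i).2) hcB hWB hs _
  refine count_aux hk ε ε₁ h0 hε h1 h1' _ _ _ hm ?_ ?_ ?_ ?_
  · intro i
    rw [trace_specProj]
    refine Finset.sum_nonneg fun j _ => ?_
    rw [qf_conj (hV i).1]
    exact qf_nonneg hB _
  · intro i
    apply trace_mono
    intro v
    rw [qf_conj (hV i).1, qf_conj (hV i).1, qf_add]
    linarith [qf_nonneg hA (TT (V i) v)]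
  · rw [s1, s2]
    have : ((specProj hAB * (A + B)).trace).re =
      ((specProj hAB * A).trace).re + ((specProj hAB * B).trace).re := by
      rw [mul_add, Matrix.trace_add, Complex.add_re]
    linarith
  · rw [s1, s3]
    exact hJ
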